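/- arXiv:math/0507395 — 4 statements merged into one kernel-verified Lean document; each statement's English description precedes it below -/
import Mathlib

section
/- For any topological space Y, the four spaces susp(cone(Y)), cone(susp(Y)), cone(cone(Y)), and cone(Y) × [0,1] are mutually homeomorphic. -/
open unitInterval Set

/-- Relation identifying `L × {0}` to a point in `L × [0,1]`. -/
def ConeRel (L : Type*) [TopologicalSpace L] (p q : L × I) : Prop :=
  p = q ∨ (p.2 = 0 ∧ q.2 = 0)

/-- The cone on a topological space `L`: the quotient `L × [0,1] / (L × {0})`,
with the quotient topology. -/
def TopCone (L : Type*) [TopologicalSpace L] : Type _ := Quot (ConeRel L)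

instance (L : Type*) [TopologicalSpace L] : TopologicalSpace (TopCone L) :=
  inferInstanceAs (TopologicalSpace (Quot (ConeRel L)))

/-- The point `t·z` of the cone, i.e. the image of `(z,t)` under the quotient map.
Thus `conePt z 1` is the point `z` of the base and `conePt z 0` is the cone point. -/
def conePt {L : Type*} [TopologicalSpace L] (z : L) (t : I) : TopCone L :=
  Quot.mk _ (z, t)

/-- Relation on `L × [0,1]` identifying `L × {0}` to one point and `L × {1}` to another. -/
def SuspRel (L : Type*) [TopologicalSpace L] (p q : L × I) : Prop :=
  p = q ∨ (p.2 = 0 ∧ q.2 = 0) ∨ (p.2 = 1 ∧ q.2 = 1)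

/-- The suspension of a topological space `L`, with the quotient topology;
the images of `L × {0}` and `L × {1}` are the two suspension points. -/
def TopSusp (L : Type*) [TopologicalSpace L] : Type _ := Quot (SuspRel L)

instance (L : Type*) [TopologicalSpace L] : TopologicalSpace (TopSusp L) :=
  inferInstanceAs (TopologicalSpace (Quot (SuspRel L)))

/-- The image of `(z,t)` in the suspension. -/
def suspPt {L : Type*} [TopologicalSpace L] (z : L) (t : I) : TopSusp L :=
  Quot.mk _ (z, t)

open Topology

theorem isQuotientMap_conePt {L : Type*} [TopologicalSpace L] :
    IsQuotientMap fun p : L × I => conePt p.1 p.2 := isQuotientMap_quot_mk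

theorem isQuotientMap_suspPt {L : Type*} [TopologicalSpace L] :
    IsQuotientMap fun p : L × I => suspPt p.1 p.2 := isQuotientMap_quot_mk

theorem conePt_eq_conePt_iff {L : Type*} [TopologicalSpace L] {z z' : L} {t t' : I} :
    conePt z t = conePt z' t' ↔ (z = z' ∧ t = t') ∨ (t = 0 ∧ t' = 0) := by
  have h : Equivalence (ConeRel L) :=
    ⟨fun _ => .inl rfl, by unfold ConeRel; grind, by unfold ConeRel; grind⟩
  exact (h.quot_mk_eq_iff (z, t) (z', t')).trans (by simp [ConeRel])

theorem suspPt_eq_suspPt_iff {L : Type*} [TopologicalSpace L] {z z' : L} {t t' : I} :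
    suspPt z t = suspPt z' t' ↔
      (z = z' ∧ t = t') ∨ (t = 0 ∧ t' = 0) ∨ (t = 1 ∧ t' = 1) := by
  have h : Equivalence (SuspRel L) :=
    ⟨fun _ => .inl rfl, by unfold SuspRel; grind, by
      have : (0 : I) ≠ 1 := zero_ne_one
      unfold SuspRel; grind⟩
  exact (h.quot_mk_eq_iff (z, t) (z', t')).trans (by simp [SuspRel])

/-- The product of a quotient map with a locally compact space is a quotient map. -/
theorem Topology.IsQuotientMap.prodMap_id_of_locallyCompact {A B K : Type*} [TopologicalSpace A]
    [TopologicalSpace B] [TopologicalSpace K] [LocallyCompactSpace K] {f : A → B}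
    (hf : IsQuotientMap f) : IsQuotientMap (Prod.map f (id : K → K)) := by
  refine (isQuotientMap_iff _).2 ⟨isCoinducing_iff.2 fun s => ⟨fun hs => ?_, fun hs =>
    hs.preimage (hf.continuous.prodMap continuous_id)⟩,
    hf.surjective.prodMap Function.surjective_id⟩
  have : Continuous fun p : B × K => p ∈ s :=
    hf.continuous_lift_prod_left (continuous_Prop.2 hs)
  exact continuous_Prop.1 this

theorem nonempty_homeomorph_of_isQuotientMap {Z A B : Type*} [TopologicalSpace Z]
    [TopologicalSpace A] [TopologicalSpace B] {f : Z → A} {g : Z → B}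
    (hf : IsQuotientMap f) (hg : IsQuotientMap g) (h : ∀ x y, f x = f y ↔ g x = g y) :
    Nonempty (A ≃ₜ B) := by
  have hk : Setoid.ker f = Setoid.ker g := Setoid.ext h
  have e : Quotient (Setoid.ker f) ≃ₜ A :=
    Topology.IsQuotientMap.homeomorph (f := ⟨f, hf.continuous⟩) hf
  rw [hk] at e
  exact ⟨e.symm.trans (Topology.IsQuotientMap.homeomorph (f := ⟨g, hg.continuous⟩) hg)⟩

/-- A triangle in the plane, with one side on the axis `{u = 0}`. -/
def halfDiamond : Set (ℝ × ℝ) := {p | 0 ≤ p.1 ∧ p.1 + |p.2| ≤ 1}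

/-- The relation on `Y × halfDiamond` collapsing `Y` over the side `{u = 0}`. -/
def halfDiamondSetoid (Y : Type*) : Setoid (Y × halfDiamond) where
  r a b := a.2 = b.2 ∧ (a.1 = b.1 ∨ a.2.1.1 = 0)
  iseqv := ⟨by grind, by grind, by grind⟩

theorem nonempty_homeomorph_halfDiamond {Y X : Type*} [TopologicalSpace Y] [TopologicalSpace X]
    {q : (Y × I) × I → X} (hq : IsQuotientMap q) {φ : I × I → ℝ × ℝ} (hφ : Continuous φ)
    (hrange : range φ = halfDiamond)
    (h : ∀ y s t y' s' t', q ((y, s), t) = q ((y', s'), t') ↔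
      φ (s, t) = φ (s', t') ∧ (y = y' ∨ (φ (s, t)).1 = 0)) :
    Nonempty (X ≃ₜ Quotient (halfDiamondSetoid Y)) := by
  let ψ : I × I → halfDiamond := fun p => ⟨φ p, hrange ▸ mem_range_self p⟩
  have hψ : Continuous ψ := hφ.subtype_mk _
  have hsurj : Function.Surjective ψ := by
    rintro ⟨x, hx⟩
    rw [← hrange] at hx
    obtain ⟨p, rfl⟩ := hx
    exact ⟨p, rfl⟩
  have hid : IsQuotientMap (Prod.map (id : Y → Y) ψ) :=
    (isProperMap_id.prodMap hψ.isProperMap).isClosedMap.isQuotientMap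
      (continuous_id.prodMap hψ) (Function.surjective_id.prodMap hsurj)
  have hM : IsQuotientMap (Quotient.mk (halfDiamondSetoid Y)) := isQuotientMap_quotient_mk'
  refine nonempty_homeomorph_of_isQuotientMap hq
    ((hM.comp hid).comp (Homeomorph.prodAssoc Y I I).isQuotientMap) ?_
  rintro ⟨⟨y, s⟩, t⟩ ⟨⟨y', s'⟩, t'⟩
  refine (h y s t y' s' t').trans (Iff.trans ?_ Quotient.eq.symm)
  exact and_congr_left' (Subtype.ext_iff (a1 := ψ (s, t)) (a2 := ψ (s', t'))).symm

theorem nonempty_homeomorph_cone_prod (Y : Type*) [TopologicalSpace Y] :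
    Nonempty (TopCone Y × I ≃ₜ Quotient (halfDiamondSetoid Y)) := by
  refine nonempty_homeomorph_halfDiamond (q := fun p => (conePt p.1.1 p.1.2, p.2))
    (φ := fun p => (max ((p.1 : ℝ) / 2) (p.1 - |2 * (p.2 : ℝ) - 1| / 2),
      (2 * (p.2 : ℝ) - 1) / 2 +
        (max 0 (2 * (p.2 : ℝ) - 1 - p.1) - max 0 (-(2 * (p.2 : ℝ) - 1) - p.1)) / 2))
    isQuotientMap_conePt.prodMap_id_of_locallyCompact (by fun_prop) ?_ ?_
  · ext ⟨u, v⟩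
    constructor
    · rintro ⟨⟨⟨s, hs0, hs1⟩, ⟨t, ht0, ht1⟩⟩, h⟩
      simp only [Prod.mk.injEq] at h
      simp only [halfDiamond, mem_ofPred_eq]
      grind
    · rintro ⟨hu, hv⟩
      simp only at hu hv
      rcases le_total |v| u with h | h
      · refine ⟨(⟨u + |v|, by grind, by grind⟩, ⟨(2 * v + 1) / 2, by grind, by grind⟩), ?_⟩
        simp only [Prod.mk.injEq]
        grind
      · rcases le_total 0 v with h0 | h0
        · refine ⟨(⟨2 * u, by grind, by grind⟩, ⟨(u + v + 1) / 2, by grind, by grind⟩), ?_⟩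
          simp only [Prod.mk.injEq]
          grind
        · refine ⟨(⟨2 * u, by grind, by grind⟩, ⟨(1 - u + v) / 2, by grind, by grind⟩), ?_⟩
          simp only [Prod.mk.injEq]
          grind
  · rintro y ⟨s, hs0, hs1⟩ ⟨t, ht0, ht1⟩ y' ⟨s', hs0', hs1'⟩ ⟨t', ht0', ht1'⟩
    simp only [Prod.mk.injEq, conePt_eq_conePt_iff, Subtype.ext_iff, Icc.coe_zero]
    by_cases hy : y = y'
    · simp only [hy, true_and, true_or, and_true]
      grind
    · simp only [hy, false_and, false_or]
      grind

theorem nonempty_homeomorph_susp_cone (Y : Type*) [TopologicalSpace Y] :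
    Nonempty (TopSusp (TopCone Y) ≃ₜ Quotient (halfDiamondSetoid Y)) := by
  refine nonempty_homeomorph_halfDiamond (q := fun p => suspPt (conePt p.1.1 p.1.2) p.2)
    (φ := fun p => ((p.1 : ℝ) * (1 - |2 * (p.2 : ℝ) - 1|), 2 * (p.2 : ℝ) - 1))
    (isQuotientMap_suspPt.comp isQuotientMap_conePt.prodMap_id_of_locallyCompact)
    (by fun_prop) ?_ ?_
  · ext ⟨u, v⟩
    constructor
    · rintro ⟨⟨⟨s, hs0, hs1⟩, ⟨t, ht0, ht1⟩⟩, h⟩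
      simp only [Prod.mk.injEq] at h
      obtain ⟨rfl, rfl⟩ := h
      have : 0 ≤ 1 - |2 * t - 1| := by grind
      constructor <;> simp only <;> nlinarith
    · rintro ⟨hu, hv⟩
      simp only at hu hv
      refine ⟨(⟨u / (1 - |v|), by apply div_nonneg <;> linarith, by
        apply div_le_one_of_le₀ <;> linarith⟩, ⟨(v + 1) / 2, by grind, by grind⟩), ?_⟩
      have e : 2 * ((v + 1) / 2) - 1 = v := by ring
      simp only [Prod.mk.injEq, e, and_true]
      exact div_mul_cancel_of_imp (by grind)
  · rintro y ⟨s, hs0, hs1⟩ ⟨t, ht0, ht1⟩ y' ⟨s', hs0', hs1'⟩ ⟨t', ht0', ht1'⟩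
    simp only [Prod.mk.injEq, suspPt_eq_suspPt_iff, conePt_eq_conePt_iff, Subtype.ext_iff,
      Icc.coe_zero, Icc.coe_one]
    have key : 1 - |2 * t - 1| = 0 ↔ t = 0 ∨ t = 1 := by grind
    have e : (2 * t - 1 = 2 * t' - 1) ↔ t = t' := by grind
    rw [e]
    by_cases ht : t = t'
    · subst ht
      simp only [mul_eq_zero, mul_eq_mul_right_iff, key]
      grind
    · grind

theorem nonempty_homeomorph_cone_susp (Y : Type*) [TopologicalSpace Y] :
    Nonempty (TopCone (TopSusp Y) ≃ₜ Quotient (halfDiamondSetoid Y)) := by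
  refine nonempty_homeomorph_halfDiamond (q := fun p => conePt (suspPt p.1.1 p.1.2) p.2)
    (φ := fun p => ((p.2 : ℝ) * (1 - |2 * (p.1 : ℝ) - 1|), (p.2 : ℝ) * (2 * (p.1 : ℝ) - 1)))
    (isQuotientMap_conePt.comp isQuotientMap_suspPt.prodMap_id_of_locallyCompact)
    (by fun_prop) ?_ ?_
  · ext ⟨u, v⟩
    constructor
    · rintro ⟨⟨⟨s, hs0, hs1⟩, ⟨t, ht0, ht1⟩⟩, h⟩
      simp only [Prod.mk.injEq] at h
      obtain ⟨rfl, rfl⟩ := h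
      have : 0 ≤ 1 - |2 * s - 1| := by grind
      refine ⟨mul_nonneg ht0 this, ?_⟩
      simp only [abs_mul, abs_of_nonneg ht0]
      linarith
    · rintro ⟨hu, hv⟩
      simp only at hu hv
      have hn : 0 ≤ u + |v| := by positivity
      have h1 : -1 ≤ v / (u + |v|) := by
        have : -v / (u + |v|) ≤ 1 := div_le_one_of_le₀ (by grind) hn
        rw [neg_div] at this
        linarith
      have h2 : v / (u + |v|) ≤ 1 := div_le_one_of_le₀ (by grind) hn
      refine ⟨(⟨(v / (u + |v|) + 1) / 2, by linarith, by linarith⟩, ⟨u + |v|, hn, hv⟩), ?_⟩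
      have e : 2 * ((v / (u + |v|) + 1) / 2) - 1 = v / (u + |v|) := by ring
      have hv' : (u + |v|) * (v / (u + |v|)) = v := mul_div_cancel_of_imp' (by grind)
      simp only [Prod.mk.injEq, e, hv', and_true]
      have : (u + |v|) * |v / (u + |v|)| = |v| := by
        rw [← abs_of_nonneg hn, ← abs_mul, abs_of_nonneg hn, hv']
      linarith
  · rintro y ⟨s, hs0, hs1⟩ ⟨t, ht0, ht1⟩ y' ⟨s', hs0', hs1'⟩ ⟨t', ht0', ht1'⟩
    simp only [Prod.mk.injEq, suspPt_eq_suspPt_iff, conePt_eq_conePt_iff, Subtype.ext_iff,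
      Icc.coe_zero, Icc.coe_one]
    have key : 1 - |2 * s - 1| = 0 ↔ s = 0 ∨ s = 1 := by grind
    have e : (t * (1 - |2 * s - 1|) = t' * (1 - |2 * s' - 1|) ∧
        t * (2 * s - 1) = t' * (2 * s' - 1)) ↔ t = t' ∧ (t = 0 ∨ s = s') := by
      constructor
      · rintro ⟨h1, h2⟩
        have h3 := congrArg abs h2
        rw [abs_mul, abs_mul, abs_of_nonneg ht0, abs_of_nonneg ht0'] at h3
        have ht : t = t' := by linarith
        subst ht
        refine ⟨rfl, or_iff_not_imp_left.2 fun h => ?_⟩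
        linarith [mul_left_cancel₀ h h2]
      · rintro ⟨rfl, rfl | rfl⟩ <;> simp
    rw [e, mul_eq_zero, key]
    grind

theorem nonempty_homeomorph_cone_cone (Y : Type*) [TopologicalSpace Y] :
    Nonempty (TopCone (TopCone Y) ≃ₜ Quotient (halfDiamondSetoid Y)) := by
  refine nonempty_homeomorph_halfDiamond (q := fun p => conePt (conePt p.1.1 p.1.2) p.2)
    (φ := fun p => ((p.2 : ℝ) * p.1, -1 + (p.2 : ℝ) * (2 - p.1)))
    (isQuotientMap_conePt.comp isQuotientMap_conePt.prodMap_id_of_locallyCompact)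
    (by fun_prop) ?_ ?_
  · ext ⟨u, v⟩
    constructor
    · rintro ⟨⟨⟨s, hs0, hs1⟩, ⟨t, ht0, ht1⟩⟩, h⟩
      simp only [Prod.mk.injEq] at h
      obtain ⟨rfl, rfl⟩ := h
      refine ⟨mul_nonneg ht0 hs0, ?_⟩
      simp only
      rw [← le_sub_iff_add_le', abs_le]
      constructor <;> nlinarith
    · rintro ⟨hu, hv⟩
      simp only at hu hv
      have h := neg_abs_le v
      have h' := le_abs_self v
      refine ⟨(⟨u / ((u + v + 1) / 2), by apply div_nonneg <;> linarith, by
        apply div_le_one_of_le₀ <;> linarith⟩, ⟨(u + v + 1) / 2, by linarith, by linarith⟩), ?_⟩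
      have e : (u + v + 1) / 2 * (u / ((u + v + 1) / 2)) = u :=
        mul_div_cancel_of_imp' (by intro; linarith)
      simp only [Prod.mk.injEq, mul_sub, e, true_and]
      ring
  · rintro y ⟨s, hs0, hs1⟩ ⟨t, ht0, ht1⟩ y' ⟨s', hs0', hs1'⟩ ⟨t', ht0', ht1'⟩
    simp only [Prod.mk.injEq, conePt_eq_conePt_iff, Subtype.ext_iff, Icc.coe_zero]
    have e : (t * s = t' * s' ∧ -1 + t * (2 - s) = -1 + t' * (2 - s')) ↔
        t = t' ∧ (t = 0 ∨ s = s') := by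
      constructor
      · rintro ⟨h1, h2⟩
        have ht : t = t' := by linarith
        subst ht
        exact ⟨rfl, or_iff_not_imp_left.2 fun h => mul_left_cancel₀ h h1⟩
      · rintro ⟨rfl, rfl | rfl⟩ <;> simp
    rw [e, mul_eq_zero]
    grind

/-- **Lemma.** For any space `Y`, the spaces `susp(cone(Y))`, `cone(susp(Y))`,
`cone(cone(Y))`, and `cone(Y) × [0,1]` are mutually homeomorphic. -/
theorem suspCone_cone_homeomorphisms (Y : Type*) [TopologicalSpace Y] :
    Nonempty (TopSusp (TopCone Y) ≃ₜ TopCone (TopSusp Y)) ∧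
    Nonempty (TopSusp (TopCone Y) ≃ₜ TopCone (TopCone Y)) ∧
    Nonempty (TopSusp (TopCone Y) ≃ₜ TopCone Y × I) := by
  obtain ⟨e⟩ := nonempty_homeomorph_susp_cone Y
  obtain ⟨e₁⟩ := nonempty_homeomorph_cone_susp Y
  obtain ⟨e₂⟩ := nonempty_homeomorph_cone_cone Y
  obtain ⟨e₃⟩ := nonempty_homeomorph_cone_prod Y
  exact ⟨⟨e.trans e₁.symm⟩, ⟨e.trans e₂.symm⟩, ⟨e.trans e₃.symm⟩⟩
end

section
/- Let f : Y → K be a continuous map. Let D = (Y × [0,1]) ∪ (Map(f) × {0,1}), viewed as a subspace of Map(f) × [0,1] (where Y ⊆ Map(f) is the top of the cylinder). Then there exist a continuous map F : D → K and a homeomorphism Φ : Map(f) × [0,1] → Map(F) such that Φ(k, 1/2) = k for every k ∈ K; in particular Φ carries the pair (Map(f) × [0,1], K × {1/2}) homeomorphically onto the pair (Map(F), K). -/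
open unitInterval Set

/-- Relation generating the mapping-cylinder identification `(x,0) ∼ f x`. -/
def MapCylRel {L K : Type*} (f : L → K) : ((L × I) ⊕ K) → ((L × I) ⊕ K) → Prop :=
  fun p q => ∃ x : L, p = Sum.inl (x, 0) ∧ q = Sum.inr (f x)

/-- The mapping cylinder of `f : L → K`: the quotient of `(L × [0,1]) ⊔ K` obtained by
identifying `(x,0)` with `f x`, with the quotient topology. -/
def MapCyl {L K : Type*} [TopologicalSpace L] [TopologicalSpace K] (f : L → K) : Type _ :=
  Quot (MapCylRel f)

instance {L K : Type*} [TopologicalSpace L] [TopologicalSpace K] (f : L → K) :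
    TopologicalSpace (MapCyl f) :=
  inferInstanceAs (TopologicalSpace (Quot (MapCylRel f)))

/-- The image of `(x,t) ∈ L × [0,1]` in the mapping cylinder; the points `cylIn f x 1`
form the embedded copy of `L` (the top of the cylinder). -/
def cylIn {L K : Type*} [TopologicalSpace L] [TopologicalSpace K] (f : L → K)
    (x : L) (t : I) : MapCyl f :=
  Quot.mk _ (Sum.inl (x, t))

/-- The canonical embedded copy of `K` (the range end) in the mapping cylinder. -/
def cylK {L K : Type*} [TopologicalSpace L] [TopologicalSpace K] (f : L → K)
    (k : K) : MapCyl f :=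
  Quot.mk _ (Sum.inr k)

open Topology

section MapCyl

variable {L K : Type*} [TopologicalSpace L] [TopologicalSpace K]

/-- The retraction of the mapping cylinder of `f` onto its range end. -/
def cylRetract (f : L → K) : MapCyl f → K :=
  Quot.lift (Sum.elim (fun p => f p.1) id) (by rintro _ _ ⟨x, rfl, rfl⟩; rfl)

/-- The height above the range end in the mapping cylinder. -/
def cylHeight (f : L → K) : MapCyl f → I :=
  Quot.lift (Sum.elim Prod.snd fun _ => 0) (by rintro _ _ ⟨x, rfl, rfl⟩; rfl)

theorem cylIn_zero (f : L → K) (x : L) : cylIn f x 0 = cylK f (f x) :=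
  Quot.sound ⟨x, rfl, rfl⟩

/-- Multiplication of the height by a real number, truncated to `[0,1]`. -/
noncomputable def cylScale (f : L → K) (a : ℝ) : MapCyl f → MapCyl f :=
  Quot.lift
    (Sum.elim (fun p => cylIn f p.1 (projIcc 0 1 zero_le_one (a * p.2))) (cylK f)) (by
      rintro _ _ ⟨x, rfl, rfl⟩
      have h : projIcc (0 : ℝ) 1 zero_le_one (a * ((0 : I) : ℝ)) = 0 := by simp
      simp only [Sum.elim_inl, Sum.elim_inr, h, cylIn_zero])

theorem cylScale_cylIn (f : L → K) (a : ℝ) (x : L) (s : I) :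
    cylScale f a (cylIn f x s) = cylIn f x (projIcc 0 1 zero_le_one (a * s)) :=
  rfl

theorem MapCyl.ind {f : L → K} {P : MapCyl f → Prop} (hI : ∀ x t, P (cylIn f x t))
    (hK : ∀ k, P (cylK f k)) (m : MapCyl f) : P m := by
  obtain ⟨⟨x, t⟩ | k, rfl⟩ := Quot.exists_rep m
  exacts [hI x t, hK k]

theorem projIcc_coe_mul (t s : I) :
    projIcc (0 : ℝ) 1 zero_le_one ((t : ℝ) * s) = t * s :=
  projIcc_val zero_le_one (t * s)

theorem cylScale_cylIn_coe (f : L → K) (t : I) (x : L) (s : I) :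
    cylScale f t (cylIn f x s) = cylIn f x (t * s) := by
  rw [cylScale_cylIn, projIcc_coe_mul]

theorem cylScale_inv_cylScale (f : L → K) {t : I} (ht : t ≠ 0) (m : MapCyl f) :
    cylScale f (t : ℝ)⁻¹ (cylScale f t m) = m := by
  have ht' : (t : ℝ) ≠ 0 := fun h => ht (Subtype.ext h)
  induction m using MapCyl.ind with
  | hI x s =>
    rw [cylScale_cylIn_coe, cylScale_cylIn, Icc.coe_mul, inv_mul_cancel_left₀ ht', projIcc_val]
  | hK k => rfl

theorem cylScale_zero (f : L → K) (m : MapCyl f) :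
    cylScale f ((0 : I) : ℝ) m = cylK f (cylRetract f m) := by
  induction m using MapCyl.ind with
  | hI x s => rw [cylScale_cylIn_coe, zero_mul, cylIn_zero]; rfl
  | hK k => rfl

theorem cylRetract_cylScale (f : L → K) (a : ℝ) (m : MapCyl f) :
    cylRetract f (cylScale f a m) = cylRetract f m := by
  induction m using MapCyl.ind <;> rfl

theorem cylHeight_cylScale (f : L → K) (t : I) (m : MapCyl f) :
    cylHeight f (cylScale f t m) = t * cylHeight f m := by
  induction m using MapCyl.ind with
  | hI x s => rw [cylScale_cylIn_coe]; rfl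
  | hK k => exact (mul_zero t).symm

theorem isQuotientMap_mapCyl (f : L → K) :
    IsQuotientMap (Quot.mk (MapCylRel f) : (L × I) ⊕ K → MapCyl f) :=
  isQuotientMap_quot_mk

@[fun_prop]
theorem continuous_cylIn (f : L → K) : Continuous fun p : L × I => cylIn f p.1 p.2 :=
  (isQuotientMap_mapCyl f).continuous.comp continuous_inl

@[fun_prop]
theorem continuous_cylK (f : L → K) : Continuous (cylK f) :=
  (isQuotientMap_mapCyl f).continuous.comp continuous_inr

/-- A map out of a mapping cylinder is continuous if it is so on both parts. -/
theorem MapCyl.continuous_of {X : Type*} [TopologicalSpace X] {f : L → K} {g : MapCyl f → X}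
    (hI : Continuous fun p : L × I => g (cylIn f p.1 p.2))
    (hK : Continuous fun k => g (cylK f k)) : Continuous g :=
  (isQuotientMap_mapCyl f).continuous_iff.2 (continuous_sum_dom.2 ⟨hI, hK⟩)

/-- A map out of the product of a mapping cylinder with a locally compact space is continuous
if it is so on both parts. -/
theorem MapCyl.continuous_prod_of {X Z : Type*} [TopologicalSpace X] [TopologicalSpace Z]
    [LocallyCompactSpace Z] {f : L → K} {g : MapCyl f × Z → X}
    (hI : Continuous fun p : (L × I) × Z => g (cylIn f p.1.1 p.1.2, p.2))
    (hK : Continuous fun p : K × Z => g (cylK f p.1, p.2)) : Continuous g := by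
  refine (isQuotientMap_mapCyl f).continuous_lift_prod_left ?_
  rw [← Homeomorph.sumProdDistrib.symm.comp_continuous_iff']
  exact continuous_sum_dom.2 ⟨hI, hK⟩

theorem continuous_cylRetract {f : L → K} (hf : Continuous f) : Continuous (cylRetract f) :=
  MapCyl.continuous_of (hf.comp continuous_fst) continuous_id

theorem continuous_cylScale (f : L → K) :
    Continuous fun p : MapCyl f × I => cylScale f p.2 p.1 := by
  refine MapCyl.continuous_prod_of ?_ ?_
  · simp only [cylScale_cylIn_coe]
    exact (continuous_cylIn f).comp
      (f := fun p : (L × I) × I => (p.1.1, p.2 * p.1.2)) (by fun_prop)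
  · exact (continuous_cylK f).comp continuous_fst

end MapCyl

/-- The affine path from `1/2` to `u`. -/
noncomputable def midScale (t u : I) : I :=
  ⟨(1 - t) / 2 + t * u, by
    constructor <;> nlinarith [t.2.2, mul_nonneg t.2.1 u.2.1, mul_le_mul_of_nonneg_left u.2.2 t.2.1]⟩

theorem continuous_midScale : Continuous fun p : I × I => midScale p.1 p.2 := by
  unfold midScale
  fun_prop

theorem abs_midScale (t u : I) :
    |2 * (midScale t u : ℝ) - 1| = t * |2 * (u : ℝ) - 1| := by
  have h : 2 * (midScale t u : ℝ) - 1 = t * (2 * (u : ℝ) - 1) := by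
    simp only [midScale]
    ring
  rw [h, abs_mul, abs_of_nonneg t.2.1]

theorem exists_midScale_eq (t u : I) (ht : |2 * (u : ℝ) - 1| ≤ t) : ∃ v, midScale t v = u := by
  rw [abs_le] at ht
  rcases t.2.1.eq_or_lt with h | h
  · refine ⟨0, Subtype.ext ?_⟩
    simp only [midScale]
    rw [← h] at ht ⊢
    linarith
  · refine ⟨⟨(2 * u - 1 + t) / (2 * t), by apply div_nonneg <;> linarith, ?_⟩, Subtype.ext ?_⟩
    · rw [div_le_one (by linarith)]; linarith
    · simp only [midScale]
      field_simp
      ring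

theorem abs_two_mul_sub_one_eq_one_iff (u : I) : |2 * (u : ℝ) - 1| = 1 ↔ u = 0 ∨ u = 1 := by
  rw [abs_eq zero_le_one, Subtype.ext_iff, Subtype.ext_iff, or_comm, Icc.coe_zero, Icc.coe_one]
  constructor <;> rintro (h | h)
  · left; linarith
  · right; linarith
  · left; linarith
  · right; linarith

/-- Every `u` lies on the segment from `1/2` to an endpoint, at parameter `|2 * u - 1|`. -/
theorem exists_endpoint_midScale_eq (u : I) :
    ∃ t v : I, (t : ℝ) = |2 * (u : ℝ) - 1| ∧ (v = 0 ∨ v = 1) ∧ midScale t v = u := by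
  have hu : |2 * (u : ℝ) - 1| ≤ 1 := abs_le.2 ⟨by linarith [u.2.1], by linarith [u.2.2]⟩
  rcases le_total (2 * (u : ℝ) - 1) 0 with h | h
  · refine ⟨⟨_, abs_nonneg _, hu⟩, 0, rfl, .inl rfl, Subtype.ext ?_⟩
    simp only [midScale, abs_of_nonpos h, Icc.coe_zero]
    ring
  · refine ⟨⟨_, abs_nonneg _, hu⟩, 1, rfl, .inr rfl, Subtype.ext ?_⟩
    simp only [midScale, abs_of_nonneg h, Icc.coe_one]
    ring

/-- The three sides of the unit square other than the side where the first coordinate is `0`. -/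
abbrev squareFrame : Set (I × I) := {e | e.1 = 1 ∨ e.2 = 0 ∨ e.2 = 1}

theorem isClosed_endpoints : IsClosed {u : I | u = 0 ∨ u = 1} :=
  (isClosed_eq continuous_id continuous_const).union (isClosed_eq continuous_id continuous_const)

theorem isClosed_squareFrame : IsClosed squareFrame :=
  (isClosed_eq continuous_fst continuous_const).union
    (isClosed_endpoints.preimage continuous_snd)

/-- The radial map from the midpoint of the side of the unit square missing in
`squareFrame` covers the square. -/
theorem surjective_squareRadial :
    Function.Surjective fun q : squareFrame × I => (q.2 * q.1.1.1, midScale q.2 q.1.1.2) := by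
  rintro ⟨s, u⟩
  obtain ⟨t, v, ht, hv, htv⟩ := exists_endpoint_midScale_eq u
  rcases le_total s t with h | h
  · rcases t.2.1.eq_or_lt with h0 | h0
    · have ht0 : t = 0 := Subtype.ext h0.symm
      have hs0 : s = 0 := le_antisymm (ht0 ▸ h) s.2.1
      exact ⟨⟨⟨(0, v), .inr hv⟩, t⟩, Prod.ext (by simp [hs0]) htv⟩
    · refine ⟨⟨⟨(⟨s / t, div_nonneg s.2.1 t.2.1, (div_le_one h0).2 h⟩, v), .inr hv⟩, t⟩,
        Prod.ext (Subtype.ext ?_) htv⟩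
      simp only [Icc.coe_mul]
      exact mul_div_cancel₀ _ h0.ne'
  · obtain ⟨w, hw⟩ := exists_midScale_eq s u (ht ▸ h)
    exact ⟨⟨⟨(1, w), .inl rfl⟩, s⟩, Prod.ext (mul_one s) hw⟩

theorem surjective_endpointRadial :
    Function.Surjective fun q : {u : I | u = 0 ∨ u = 1} × I => midScale q.2 q.1.1 := by
  intro u
  obtain ⟨t, v, -, hv, htv⟩ := exists_endpoint_midScale_eq u
  exact ⟨⟨⟨v, hv⟩, t⟩, htv⟩

/-- The product of the identity with a continuous surjection from a compact space onto a
Hausdorff space is a quotient map. -/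
theorem isQuotientMap_id_prodMap {X A B : Type*} [TopologicalSpace X] [TopologicalSpace A]
    [TopologicalSpace B] [CompactSpace A] [T2Space B] {h : A → B} (hc : Continuous h)
    (hs : Function.Surjective h) : IsQuotientMap (Prod.map (id : X → X) h) :=
  (isProperMap_id.prodMap hc.isProperMap).isClosedMap.isQuotientMap
    (continuous_id.prodMap hc) (Function.surjective_id.prodMap hs)

section Frame

variable {L K : Type*} [TopologicalSpace L] [TopologicalSpace K]

/-- The union of the top, `L × [0,1]`, and the two ends of `MapCyl f × [0,1]`. -/
abbrev cylFrame (f : L → K) : Set (MapCyl f × I) :=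
  {p | (∃ x : L, p.1 = cylIn f x 1) ∨ p.2 = 0 ∨ p.2 = 1}

/-- The retraction onto the range end, as a map on the frame of `MapCyl f × [0,1]`. -/
def frameMap (f : L → K) (d : cylFrame f) : K := cylRetract f d.1.1

/-- The radial map from the mapping cylinder of `frameMap f` to `MapCyl f × [0,1]`. -/
noncomputable def frameRadial (f : L → K) : MapCyl (frameMap f) → MapCyl f × I :=
  Quot.lift
    (Sum.elim (fun p => (cylScale f p.2 p.1.1.1, midScale p.2 p.1.1.2))
      fun k => (cylK f k, ⟨1 / 2, by norm_num⟩)) (by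
    rintro _ _ ⟨d, rfl, rfl⟩
    exact Prod.ext (cylScale_zero f _) (Subtype.ext (by simp [midScale])))

theorem frameRadial_cylIn (f : L → K) (d : cylFrame f) (t : I) :
    frameRadial f (cylIn _ d t) = (cylScale f t d.1.1, midScale t d.1.2) :=
  rfl

theorem frameRadial_cylK (f : L → K) (k : K) :
    frameRadial f (cylK _ k) = (cylK f k, ⟨1 / 2, by norm_num⟩) :=
  rfl

theorem continuous_frameRadial (f : L → K) : Continuous (frameRadial f) := by
  refine MapCyl.continuous_of ?_ ((continuous_cylK f).prodMk continuous_const)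
  simp only [frameRadial_cylIn]
  exact ((continuous_cylScale f).comp (f := fun p : cylFrame f × I => (p.1.1.1, p.2))
    (by fun_prop)).prodMk
      (continuous_midScale.comp (f := fun p : cylFrame f × I => (p.2, p.1.1.2)) (by fun_prop))

/-- The distance from `K × {1/2}` in `MapCyl f × [0,1]`, normalized to be `1` on the frame. -/
noncomputable def coreDist (f : L → K) (p : MapCyl f × I) : ℝ :=
  max (cylHeight f p.1 : ℝ) |2 * (p.2 : ℝ) - 1|

theorem coreDist_eq_one (f : L → K) (d : cylFrame f) : coreDist f d.1 = 1 := by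
  obtain ⟨⟨m, u⟩, ⟨x, h⟩ | h⟩ := d
  · have hm : cylHeight f m = 1 := congrArg (cylHeight f) h
    simp only [coreDist, hm, Icc.coe_one]
    exact max_eq_left (abs_le.2 ⟨by linarith [u.2.1], by linarith [u.2.2]⟩)
  · have hu := (abs_two_mul_sub_one_eq_one_iff u).2 h
    simp only [coreDist, hu]
    exact max_eq_right (cylHeight f m).2.2

theorem coreDist_frameRadial_cylIn (f : L → K) (d : cylFrame f) (t : I) :
    coreDist f (frameRadial f (cylIn _ d t)) = t := by
  rw [frameRadial_cylIn, coreDist]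
  simp only [cylHeight_cylScale, abs_midScale, Icc.coe_mul]
  rw [← mul_max_of_nonneg _ _ t.2.1]
  exact (congrArg _ (coreDist_eq_one f d)).trans (mul_one _)

theorem coreDist_frameRadial_cylK (f : L → K) (k : K) :
    coreDist f (frameRadial f (cylK _ k)) = 0 := by
  rw [frameRadial_cylK, coreDist]
  norm_num [cylHeight, cylK]

theorem cylRetract_frameRadial (f : L → K) (z : MapCyl (frameMap f)) :
    cylRetract f (frameRadial f z).1 = cylRetract (frameMap f) z := by
  induction z using MapCyl.ind with
  | hI d t => exact cylRetract_cylScale f t _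
  | hK k => rfl

theorem MapCyl.eq_cylK_or (f : L → K) (z : MapCyl f) :
    z = cylK f (cylRetract f z) ∨ ∃ x t, t ≠ 0 ∧ z = cylIn f x t := by
  induction z using MapCyl.ind with
  | hI x t =>
    by_cases ht : t = 0
    · exact .inl (by rw [ht, cylIn_zero]; rfl)
    · exact .inr ⟨x, t, ht, rfl⟩
  | hK k => exact .inl rfl

theorem injective_frameRadial (f : L → K) : Function.Injective (frameRadial f) := by
  intro z w h
  have hr := cylRetract_frameRadial f z
  rw [h, cylRetract_frameRadial] at hr
  have hd := congrArg (coreDist f) h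
  rcases MapCyl.eq_cylK_or _ z with hz | ⟨d, t, ht, rfl⟩ <;>
    rcases MapCyl.eq_cylK_or _ w with hw | ⟨e, s, hs, rfl⟩
  · rw [hz, hw, hr]
  · rw [hz, coreDist_frameRadial_cylK, coreDist_frameRadial_cylIn] at hd
    exact absurd (Subtype.ext hd.symm) hs
  · rw [hw, coreDist_frameRadial_cylK, coreDist_frameRadial_cylIn] at hd
    exact absurd (Subtype.ext hd) ht
  · rw [coreDist_frameRadial_cylIn, coreDist_frameRadial_cylIn] at hd
    obtain rfl : t = s := Subtype.ext hd
    rw [frameRadial_cylIn, frameRadial_cylIn, Prod.mk.injEq] at h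
    have h1 := congrArg (cylScale f (t : ℝ)⁻¹) h.1
    rw [cylScale_inv_cylScale f ht, cylScale_inv_cylScale f ht] at h1
    have h2 := congrArg Subtype.val h.2
    simp only [midScale, add_right_inj] at h2
    have h3 := mul_left_cancel₀ (fun h0 => ht (Subtype.ext h0)) h2
    rw [Subtype.ext (Prod.ext h1 (Subtype.ext h3)) (a1 := d) (a2 := e)]

/-- The frame of the unit square, over each point of `L`, inside the frame of the cylinder. -/
def frameIn (f : L → K) (x : L) (e : squareFrame) : cylFrame f :=
  ⟨(cylIn f x e.1.1, e.1.2), e.2.imp_left fun h => ⟨x, by rw [h]⟩⟩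

/-- The two copies of `K` in the frame of the cylinder. -/
def frameK (f : L → K) (k : K) (v : {u : I | u = 0 ∨ u = 1}) : cylFrame f :=
  ⟨(cylK f k, v.1), .inr v.2⟩

theorem frameRadial_frameIn (f : L → K) (x : L) (e : squareFrame) (t : I) :
    frameRadial f (cylIn _ (frameIn f x e) t) =
      (cylIn f x (t * e.1.1), midScale t e.1.2) := by
  rw [frameRadial_cylIn, frameIn, cylScale_cylIn_coe]

theorem frameRadial_frameK (f : L → K) (k : K) (v : {u : I | u = 0 ∨ u = 1}) (t : I) :
    frameRadial f (cylIn _ (frameK f k v) t) = (cylK f k, midScale t v) :=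
  rfl

theorem surjective_frameRadial (f : L → K) : Function.Surjective (frameRadial f) := by
  rintro ⟨m, u⟩
  induction m using MapCyl.ind with
  | hI x s =>
    obtain ⟨⟨e, t⟩, h⟩ := surjective_squareRadial (s, u)
    obtain ⟨rfl, rfl⟩ := Prod.mk.inj h
    exact ⟨_, frameRadial_frameIn f x e t⟩
  | hK k =>
    obtain ⟨⟨v, t⟩, rfl⟩ := surjective_endpointRadial u
    exact ⟨_, frameRadial_frameK f k v t⟩

/-- The radial map as a bijection. -/
noncomputable def frameRadialEquiv (f : L → K) : MapCyl (frameMap f) ≃ MapCyl f × I :=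
  Equiv.ofBijective (frameRadial f) ⟨injective_frameRadial f, surjective_frameRadial f⟩

theorem continuous_frameRadialEquiv_symm (f : L → K) :
    Continuous (frameRadialEquiv f).symm := by
  refine MapCyl.continuous_prod_of ?_ ?_
  · have : CompactSpace squareFrame := isCompact_iff_compactSpace.1 isClosed_squareFrame.isCompact
    rw [← (Homeomorph.prodAssoc L I I).symm.comp_continuous_iff',
      (isQuotientMap_id_prodMap (X := L) (h := fun q : squareFrame × I =>
        (q.2 * q.1.1.1, midScale q.2 q.1.1.2)) ?_ surjective_squareRadial).continuous_iff]
    · have h : Continuous fun p : L × (squareFrame × I) =>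
          cylIn (frameMap f) (frameIn f p.1 p.2.1) p.2.2 := by
        refine (continuous_cylIn (frameMap f)).comp
          (f := fun p : L × (squareFrame × I) => (frameIn f p.1 p.2.1, p.2.2)) ?_
        refine .prodMk (.subtype_mk (.prodMk ?_ (by fun_prop)) _) (by fun_prop)
        exact (continuous_cylIn f).comp
          (f := fun p : L × (squareFrame × I) => (p.1, p.2.1.1.1)) (by fun_prop)
      refine h.congr fun p => ?_
      exact ((frameRadialEquiv f).symm_apply_eq.2
        (frameRadial_frameIn f p.1 p.2.1 p.2.2).symm).symm
    · exact .prodMk (by fun_prop) (continuous_midScale.comp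
        (f := fun q : squareFrame × I => (q.2, q.1.1.2)) (by fun_prop))
  · have : CompactSpace {u : I | u = 0 ∨ u = 1} :=
      isCompact_iff_compactSpace.1 isClosed_endpoints.isCompact
    rw [(isQuotientMap_id_prodMap (X := K) (h := fun q : {u : I | u = 0 ∨ u = 1} × I =>
        midScale q.2 q.1.1) ?_ surjective_endpointRadial).continuous_iff]
    · have h : Continuous fun p : K × ({u : I | u = 0 ∨ u = 1} × I) =>
          cylIn (frameMap f) (frameK f p.1 p.2.1) p.2.2 := by
        refine (continuous_cylIn (frameMap f)).comp
          (f := fun p : K × ({u : I | u = 0 ∨ u = 1} × I) => (frameK f p.1 p.2.1, p.2.2)) ?_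
        exact .prodMk (.subtype_mk (.prodMk ((continuous_cylK f).comp continuous_fst)
          (by fun_prop)) _) (by fun_prop)
      refine h.congr fun p => ?_
      exact ((frameRadialEquiv f).symm_apply_eq.2
        (frameRadial_frameK f p.1 p.2.1 p.2.2).symm).symm
    · exact continuous_midScale.comp
        (f := fun q : {u : I | u = 0 ∨ u = 1} × I => (q.2, q.1.1)) (by fun_prop)

/-- The radial map as a homeomorphism. -/
noncomputable def frameRadialHomeomorph (f : L → K) : MapCyl (frameMap f) ≃ₜ MapCyl f × I where
  toEquiv := frameRadialEquiv f
  continuous_toFun := continuous_frameRadial f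
  continuous_invFun := continuous_frameRadialEquiv_symm f

end Frame

/-- **Lemma (cylinder × interval).** For a continuous map `f : Y → K`, let
`D = (Y × [0,1]) ∪ (Map(f) × {0,1}) ⊆ Map(f) × [0,1]` (with `Y ⊆ Map(f)` the top of the
cylinder).  Then there is a continuous `F : D → K` and a homeomorphism
`Φ : Map(f) × [0,1] ≃ₜ Map(F)` with `Φ(k, 1/2) = k` for every `k ∈ K`; in particular `Φ`
carries `K × {1/2}` onto the copy of `K` in `Map(F)`. -/
theorem mapCyl_prod_unitInterval (Y K : Type*) [TopologicalSpace Y] [TopologicalSpace K]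
    (f : Y → K) (hf : Continuous f) :
    ∃ F : {p : MapCyl f × I | (∃ x : Y, p.1 = cylIn f x 1) ∨ p.2 = 0 ∨ p.2 = 1} → K,
      Continuous F ∧
      ∃ Φ : (MapCyl f × I) ≃ₜ MapCyl F,
        (∀ k : K, Φ (cylK f k, ⟨1/2, by norm_num⟩) = cylK F k) ∧
        (⇑Φ) '' {p : MapCyl f × I | ∃ k : K, p = (cylK f k, ⟨1/2, by norm_num⟩)} =
          Set.range (cylK F) := by
  have hΦ (k : K) : (frameRadialHomeomorph f).symm (cylK f k, ⟨1/2, by norm_num⟩) =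
      cylK (frameMap f) k :=
    (frameRadialEquiv f).symm_apply_eq.2 (frameRadial_cylK f k).symm
  refine ⟨frameMap f, (continuous_cylRetract hf).comp (continuous_fst.comp continuous_subtype_val),
    (frameRadialHomeomorph f).symm, hΦ, ?_⟩
  ext z
  constructor
  · rintro ⟨_, ⟨k, rfl⟩, rfl⟩
    exact ⟨k, (hΦ k).symm⟩
  · rintro ⟨k, rfl⟩
    exact ⟨_, ⟨k, rfl⟩, hΦ k⟩
end

section
/- Let X be an absolute cone, with link L_x and structure homeomorphism h_x : cone(L_x) → X for each x ∈ X. Then for every x ∈ X and every z ∈ L_x, the complement X ∖ {z} is contractible, and the link L_z of z is contractible. -/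
open unitInterval Set

open Topology

namespace TopCone

variable {L : Type*} [TopologicalSpace L]

theorem coneRel_equivalence (L : Type*) [TopologicalSpace L] : Equivalence (ConeRel L) where
  refl _ := Or.inl rfl
  symm := by
    rintro p q (rfl | ⟨hp, hq⟩)
    exacts [Or.inl rfl, Or.inr ⟨hq, hp⟩]
  trans := by
    rintro p q r (rfl | ⟨hp, hq⟩) (rfl | ⟨hq', hr⟩)
    exacts [Or.inl rfl, Or.inr ⟨hq', hr⟩, Or.inr ⟨hp, hq⟩, Or.inr ⟨hp, hr⟩]

theorem mk_eq_mk_iff {p q : L × I} :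
    (Quot.mk _ p : TopCone L) = Quot.mk _ q ↔ ConeRel L p q :=
  (coneRel_equivalence L).quot_mk_eq_iff p q

theorem exists_eq_conePt (c : TopCone L) : ∃ y t, c = conePt y t := by
  obtain ⟨⟨y, t⟩, rfl⟩ := Quot.exists_rep c
  exact ⟨y, t, rfl⟩

theorem conePt_zero_eq (y w : L) : conePt y 0 = conePt w 0 :=
  Quot.sound (Or.inr ⟨rfl, rfl⟩)

theorem eq_of_conePt_eq_conePt {y w : L} {s t : I} (h : conePt y s = conePt w t) (ht : t ≠ 0) :
    y = w ∧ s = t := by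
  rcases mk_eq_mk_iff.1 h with h | h
  · simpa using h
  · exact absurd h.2 ht

theorem isQuotientMap_mk : IsQuotientMap (Quot.mk (ConeRel L) : L × I → TopCone L) :=
  isQuotientMap_quot_mk

/-- The second coordinate of a point of the cone. -/
def height (c : TopCone L) : I :=
  Quot.lift Prod.snd (by
    rintro p q (rfl | ⟨hp, hq⟩)
    exacts [rfl, hp.trans hq.symm]) c

theorem continuous_height : Continuous (height : TopCone L → I) :=
  isQuotientMap_mk.continuous_iff.2 continuous_snd

/-- Radial scaling of the cone, taking `(t·y, s)` to `(ts)·y`. -/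
def scale (p : TopCone L × I) : TopCone L :=
  Quot.lift (fun q : L × I => conePt q.1 (q.2 * p.2)) (by
    rintro q r (rfl | ⟨hq, hr⟩)
    · rfl
    · simpa [hq, hr] using conePt_zero_eq q.1 r.1) p.1

theorem scale_conePt (y : L) (t s : I) : scale (conePt y t, s) = conePt y (t * s) := rfl

theorem continuous_scale : Continuous (scale : TopCone L × I → TopCone L) := by
  refine isQuotientMap_mk.continuous_lift_prod_left ?_
  change Continuous fun p : (L × I) × I => (Quot.mk (ConeRel L) (p.1.1, p.1.2 * p.2) : TopCone L)
  exact isQuotientMap_mk.continuous.comp (by fun_prop)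

/-- The radial projection to the base, with an arbitrary value at the cone point. -/
noncomputable def proj (c : TopCone L) : L := (Quot.out c).1

theorem proj_conePt (y : L) {t : I} (ht : t ≠ 0) : proj (conePt y t) = y :=
  (eq_of_conePt_eq_conePt (Quot.out_eq (conePt y t)) ht).1

theorem continuousOn_proj : ContinuousOn (proj : TopCone L → L) {c | height c ≠ 0} := by
  refine (isQuotientMap_mk.continuousOn_isOpen_iff
    (isOpen_compl_singleton.preimage continuous_height)).2 ?_
  exact continuous_fst.continuousOn.congr fun p hp => proj_conePt p.1 hp

end TopCone

/-- A retract of a contractible space is contractible. -/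
theorem ContractibleSpace.of_retract {A B : Type*} [TopologicalSpace A] [TopologicalSpace B]
    [ContractibleSpace B] (i : C(A, B)) (r : C(B, A)) (h : r.comp i = .id A) :
    ContractibleSpace A := by
  rw [contractible_iff_id_nullhomotopic, ← h]
  have hi : i.Nullhomotopic := (id_nullhomotopic B).comp_left i
  exact hi.comp_right r

section AbsoluteCone

open TopCone

variable {X : Type*} [TopologicalSpace X] {L : Set X} {x : X}

/-- Contracting a cone towards its tip contracts the complement of a base point. -/
theorem contractibleSpace_compl_base (h : TopCone L ≃ₜ X)
    (hbase : ∀ y : L, h (conePt y 1) = y) (htip : ∀ y : L, h (conePt y 0) = x)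
    (z : L) : ContractibleSpace ↥({(z : X)}ᶜ : Set X) := by
  have eq_z {y : L} {t s : I} (e : h (conePt y (t * s)) = z) : h (conePt y t) = z := by
    rw [← hbase z] at e
    obtain ⟨rfl, hts⟩ := eq_of_conePt_eq_conePt (h.injective e) one_ne_zero
    have ht : t = 1 := le_antisymm unitInterval.le_one' (hts ▸ unitInterval.mul_le_left)
    rw [ht, hbase]
  have hxz : x ≠ z := by
    rw [← htip z, ← hbase z]
    exact fun e => zero_ne_one (eq_of_conePt_eq_conePt (h.injective e) one_ne_zero).2
  have hmem (p : I × ↥({(z : X)}ᶜ : Set X)) : h (scale (h.symm p.2, σ p.1)) ∈ ({(z : X)}ᶜ : Set X) := by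
    obtain ⟨s, q, hq⟩ := p
    obtain ⟨y, t, hyt⟩ := exists_eq_conePt (h.symm q)
    intro e
    simp only [hyt, scale_conePt, mem_singleton_iff] at e
    exact hq (by rw [mem_singleton_iff, ← eq_z e, ← hyt, h.apply_symm_apply])
  refine (contractible_iff_id_nullhomotopic _).2 ⟨⟨x, hxz⟩, ⟨⟨⟨fun p => ⟨_, hmem p⟩, ?_⟩, ?_, ?_⟩⟩⟩
  · have := continuous_scale (L := L)
    fun_prop
  · rintro ⟨q, hq⟩
    obtain ⟨y, t, hyt⟩ := exists_eq_conePt (h.symm q)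
    ext1
    simp only [hyt, scale_conePt, unitInterval.symm_zero, mul_one]
    exact (h.symm_apply_eq.1 hyt).symm
  · rintro ⟨q, hq⟩
    obtain ⟨y, t, hyt⟩ := exists_eq_conePt (h.symm q)
    simp [hyt, scale_conePt, htip]

/-- The base of a cone is contractible as soon as the complement of its tip is. -/
theorem contractibleSpace_base (h : TopCone L ≃ₜ X)
    (hbase : ∀ y : L, h (conePt y 1) = y) (htip : ∀ y : L, h (conePt y 0) = x)
    [ContractibleSpace ↥({x}ᶜ : Set X)] : ContractibleSpace L := by
  have hmem (y : L) : (y : X) ∈ ({x}ᶜ : Set X) := by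
    rw [mem_compl_singleton_iff, ← htip y, ← hbase y]
    exact fun e => one_ne_zero (eq_of_conePt_eq_conePt (h.injective e).symm one_ne_zero).2.symm
  have hheight (q : ↥({x}ᶜ : Set X)) : height (h.symm q) ≠ 0 := by
    obtain ⟨q, hq⟩ := q
    obtain ⟨y, t, hyt⟩ := exists_eq_conePt (h.symm q)
    intro ht
    obtain rfl : t = 0 := by rwa [hyt] at ht
    exact hq (by rw [mem_singleton_iff, ← htip y, ← hyt, h.apply_symm_apply])
  refine .of_retract (B := ↥({x}ᶜ : Set X)) ⟨fun y => ⟨y, hmem y⟩, by fun_prop⟩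
    ⟨fun q => proj (h.symm q),
      continuousOn_proj.comp_continuous (by fun_prop) hheight⟩ ?_
  ext1 y
  have : h.symm y = conePt y 1 := by rw [h.symm_apply_eq, hbase]
  simp [this, proj_conePt]

end AbsoluteCone

/-- Let `X` be an absolute cone (compact metrizable), with a fixed link `Lk x` and structure
homeomorphism `hh x : cone(Lk x) ≃ₜ X` for each `x`.  Then for every `x ∈ X` and every
`z ∈ Lk x`, the complement `X ∖ {z}` is contractible and the link `Lk z` of `z` is
contractible. -/
theorem absoluteCone_link_contractible (X : Type*) [TopologicalSpace X]
    [CompactSpace X] [TopologicalSpace.MetrizableSpace X]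
    (Lk : X → Set X) (hh : ∀ x : X, TopCone (Lk x) ≃ₜ X)
    (hbase : ∀ (x : X) (z : Lk x), hh x (conePt z 1) = (z : X))
    (htip : ∀ (x : X) (z : Lk x), hh x (conePt z 0) = x)
    (x z : X) (hz : z ∈ Lk x) :
    ContractibleSpace ↥({z}ᶜ : Set X) ∧ ContractibleSpace ↥(Lk z) := by
  have : ContractibleSpace ↥({z}ᶜ : Set X) :=
    contractibleSpace_compl_base (hh x) (hbase x) (htip x) ⟨z, hz⟩
  exact ⟨this, contractibleSpace_base (hh z) (hbase z) (htip z)⟩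
end

section
/- Let Σ be a closed connected topological k-manifold with k ≥ 2 whose fundamental group is nontrivial. Then the suspension susp(Σ) is not a topological (k+1)-manifold; that is, some point of susp(Σ) (in fact each suspension point) has no open neighborhood homeomorphic to an open subset of ℝ^{k+1}. -/
open unitInterval Set

/-- If every loop in `Y` is null-homotopic and `X` is a retract of `Y`, then every loop in `X` is
null-homotopic. -/
theorem Path.Homotopic.refl_of_leftInverse {X Y : Type*} [TopologicalSpace X] [TopologicalSpace Y]
    (φ : C(X, Y)) (ψ : C(Y, X)) (h : Function.LeftInverse ψ φ)
    (hY : ∀ (y : Y) (γ : Path y y), γ.Homotopic (Path.refl y)) (x : X) (γ : Path x x) :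
    γ.Homotopic (Path.refl x) := by
  obtain ⟨F⟩ := hY (φ x) (γ.map φ.continuous)
  exact ⟨{
    toFun := fun t ↦ ψ (F t)
    map_zero_left := fun t ↦ by simp [h _]
    map_one_left := fun t ↦ by simp [h _]
    prop' := fun t s hs ↦ by
      have := F.eq_fst t hs
      simp only [ContinuousMap.coe_mk]
      rw [this]
      simp [h _] }⟩

section PuncturedConvex

variable {E : Type*} [NormedAddCommGroup E] [NormedSpace ℝ E]

/-- A path in an open subset `s` of a normed space is homotopic in `s` to a smooth path. -/
theorem Path.exists_contDiff_homotopic [FiniteDimensional ℝ E] {s : Set E} (hs : IsOpen s)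
    {x y : s} (γ : Path x y) :
    ∃ (g : ℝ → E) (γ' : Path x y), ContDiff ℝ 1 g ∧ (∀ t : I, (γ' t : E) = g t) ∧
      γ.Homotopic γ' := by
  let p : Path (x : E) y := γ.map continuous_subtype_val
  have hps : Set.range p ⊆ s := by
    rintro _ ⟨t, rfl⟩
    exact (γ t).2
  obtain ⟨ε, hε, hεs⟩ :=
    (isCompact_range p.continuous).exists_cthickening_subset_open hs hps
  have hp : UniformContinuous p.extend :=
    (CompactSpace.uniformContinuous_of_continuous p.continuous).comp
      (LipschitzWith.projIcc zero_le_one).uniformContinuous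
  obtain ⟨f, hf, hfp⟩ := hp.exists_contDiff_dist_le (ε := ε / 2) (by positivity)
  let g : ℝ → E := fun t ↦ f t - ((1 - t) • (f 0 - x) + t • (f 1 - y))
  have hg : ContDiff ℝ 1 g := by
    have := hf.of_le (m := 1) (by exact_mod_cast le_top)
    fun_prop
  have hgp (t : I) : dist (g t) (p t) ≤ ε := by
    have h0 : ‖f 0 - x‖ ≤ ε / 2 := by
      simpa [dist_eq_norm] using (hfp 0).le
    have h1 : ‖f 1 - y‖ ≤ ε / 2 := by
      simpa [dist_eq_norm] using (hfp 1).le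
    have ht : ‖f t - p t‖ ≤ ε / 2 := by
      simpa [dist_eq_norm] using (hfp t).le
    have h2 : ‖(1 - (t : ℝ)) • (f 0 - x) + (t : ℝ) • (f 1 - y)‖ ≤ ε / 2 := by
      refine (norm_add_le _ _).trans ?_
      rw [norm_smul, norm_smul, Real.norm_of_nonneg t.2.1,
        Real.norm_of_nonneg (sub_nonneg.2 t.2.2)]
      nlinarith [t.2.1, t.2.2]
    rw [dist_eq_norm]
    calc ‖g t - p t‖
        = ‖(f t - p t) - ((1 - (t : ℝ)) • (f 0 - x) + (t : ℝ) • (f 1 - y))‖ := by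
          congr 1; simp only [g]; abel
      _ ≤ ε := (norm_sub_le _ _).trans (by linarith)
  have hmem (u t : I) : AffineMap.lineMap (p t) (g t) (u : ℝ) ∈ s := by
    apply hεs
    refine Metric.mem_cthickening_of_dist_le _ (p t) _ _ ⟨t, rfl⟩ ?_
    rw [dist_lineMap_left, Real.norm_of_nonneg u.2.1, dist_comm]
    have := hgp t
    nlinarith [u.2.1, u.2.2, dist_nonneg (x := g t) (y := p t)]
  have hg0 : g 0 = x := by simp [g]
  have hg1 : g 1 = y := by simp [g]
  have hgc : Continuous g := hg.continuous
  let γ' : Path x y :=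
    { toFun := fun t ↦ ⟨g t, by simpa using hmem 1 t⟩
      continuous_toFun := by fun_prop
      source' := by ext; simpa using hg0
      target' := by ext; simpa using hg1 }
  refine ⟨g, γ', hg, fun t ↦ rfl, ⟨{
    toFun := fun q ↦ ⟨AffineMap.lineMap (p q.2) (g q.2) (q.1 : ℝ), hmem q.1 q.2⟩
    continuous_toFun := by
      simp only [AffineMap.lineMap_apply]
      fun_prop
    map_zero_left := fun t ↦ by ext; simp [p]
    map_one_left := fun t ↦ by ext; simp [γ']
    prop' := fun u t ht ↦ by
      ext
      rcases ht with rfl | rfl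
      · simp [hg0, p]
      · simp [hg1, p] }⟩⟩

/-- Every loop in a punctured open convex set of dimension at least three is null-homotopic. -/
theorem Convex.loop_homotopic_refl_diff_singleton [FiniteDimensional ℝ E]
    (hE : 2 < Module.finrank ℝ E) {s : Set E} (hs : Convex ℝ s) (hso : IsOpen s) {c : E}
    (hc : c ∈ s) (x : (s \ {c} : Set E)) (γ : Path x x) : γ.Homotopic (Path.refl x) := by
  obtain ⟨g, γ', hg, hγ', hγ⟩ := γ.exists_contDiff_homotopic (hso.sdiff isClosed_singleton)
  refine hγ.trans ?_
  have hd : Dense (Set.range fun q : ℝ × ℝ ↦ q.2 • (g q.1 - c))ᶜ := by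
    refine ContDiff.dense_compl_range_of_finrank_lt_finrank (by fun_prop) ?_
    simpa using hE
  obtain ⟨v, hvs, hv⟩ := hd.inter_open_nonempty ((fun v ↦ c + v) ⁻¹' s)
    (hso.preimage (by fun_prop)) ⟨0, by simpa using hc⟩
  have hv0 : v ≠ 0 := fun h ↦ hv ⟨(0, 0), by simp [h]⟩
  let T : Set E := {y | y ∈ s ∧ ∀ a : ℝ, 0 ≤ a → y - c ≠ -(a • v)}
  have hvT : c + v ∈ T := by
    refine ⟨hvs, fun a ha h ↦ ?_⟩
    have : (1 + a) • v = 0 := by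
      rw [add_smul, one_smul, ← eq_neg_iff_add_eq_zero, ← h]; abel
    rcases smul_eq_zero.1 this with h' | h'
    · linarith
    · exact hv0 h'
  have hT : StarConvex ℝ (c + v) T := by
    intro y hy a b ha hb hab
    refine ⟨hs hvs hy.1 ha hb hab, fun d hd h ↦ ?_⟩
    have h1 : b • (y - c) = -((a + d) • v) := by
      have : a • (c + v) + b • y - c = a • v + b • (y - c) := by
        obtain rfl : a = 1 - b := by linarith
        module
      rw [this] at h
      rw [← sub_eq_zero] at h ⊢
      rw [← h]
      module
    rcases hb.eq_or_lt with rfl | hb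
    · simp only [zero_smul, zero_eq_neg, smul_eq_zero, hv0, or_false] at h1
      linarith
    · refine hy.2 (b⁻¹ * (a + d)) (by positivity) ?_
      rw [mul_smul, ← smul_neg, ← h1, inv_smul_smul₀ hb.ne']
  have hTs : T ⊆ s \ {c} := fun y hy ↦
    ⟨hy.1, fun h ↦ hy.2 0 le_rfl (by simpa [sub_eq_zero] using h)⟩
  have := hT.contractibleSpace ⟨_, hvT⟩
  have hγT (t : I) : (γ' t : E) ∈ T := by
    refine ⟨(γ' t).2.1, fun a ha h ↦ ?_⟩
    have ha0 : a ≠ 0 := by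
      rintro rfl
      exact (γ' t).2.2 (by simpa [sub_eq_zero] using h)
    refine hv ⟨((t : ℝ), -a⁻¹), ?_⟩
    simp only [← hγ', h]
    rw [smul_neg, neg_smul, neg_neg, inv_smul_smul₀ ha0]
  let x' : T := ⟨x, by simpa using hγT 0⟩
  let δ : Path x' x' :=
    { toFun := fun t ↦ ⟨γ' t, hγT t⟩
      source' := by ext; simp [x']
      target' := by ext; simp [x'] }
  exact (SimplyConnectedSpace.paths_homotopic δ (Path.refl x')).map
    ⟨Set.inclusion hTs, continuous_inclusion hTs⟩

end PuncturedConvex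

/-- Let `h : X → I` be a height function on a space `X` with a single point `p` at height zero, whose
levels of height strictly between `0` and `1` are parametrized by a compact space `M`. If `p` has an
open neighborhood homeomorphic to an open subset of a vector space of dimension at least three,
then every loop in `M` is null-homotopic. -/
theorem loop_homotopic_refl_of_conical {E X M : Type*} [NormedAddCommGroup E] [NormedSpace ℝ E]
    [FiniteDimensional ℝ E] (hE : 2 < Module.finrank ℝ E) [TopologicalSpace X] [TopologicalSpace M]
    [CompactSpace M] {h : X → I} (hh : Continuous h) {q : M × I → X} (hq : Continuous q)
    (hhq : ∀ a, h (q a) = a.2) {p : X} (hqp : ∀ m, q (m, 0) = p) (hp0 : h p = 0)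
    (hp : ∀ x, h x = 0 → x = p)
    {ρ : X → M} (hρ : ContinuousOn ρ (h ⁻¹' Ioo 0 1))
    (hρq : ∀ m, ∀ t ∈ Ioo (0 : I) 1, ρ (q (m, t)) = m) {U : Set X} (hU : IsOpen U) (hpU : p ∈ U)
    {V : Set E} (hV : IsOpen V) (e : U ≃ₜ V) (x : M) (γ : Path x x) :
    γ.Homotopic (Path.refl x) := by
  let c : E := e ⟨p, hpU⟩
  obtain ⟨W, hWo, hW⟩ : ∃ W : Set E, IsOpen W ∧
      ∀ v : V, (v : E) ∈ W ↔ h (e.symm v) < 1 := by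
    have : IsOpen {v : V | h (e.symm v) < 1} :=
      isOpen_lt (hh.comp (continuous_subtype_val.comp e.symm.continuous)) continuous_const
    obtain ⟨W, hW, hWe⟩ := isOpen_induced_iff.1 this
    exact ⟨W, hW, fun v ↦ Set.ext_iff.1 hWe v⟩
  have hcW : c ∈ W ∩ V := ⟨(hW _).2 (by simp [hp0]), (e ⟨p, hpU⟩).2⟩
  obtain ⟨r, hr, hrW⟩ := Metric.isOpen_iff.1 (hWo.inter hV) c hcW
  let N : Set X := Subtype.val '' {u : U | (e u : E) ∈ Metric.ball c r}
  have hN : IsOpen N := hU.isOpenMap_subtype_val _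
    (Metric.isOpen_ball.preimage (continuous_subtype_val.comp e.continuous))
  have hpN : p ∈ N := ⟨⟨p, hpU⟩, Metric.mem_ball_self hr, rfl⟩
  obtain ⟨u, v, -, hv, hu, h0v, huv⟩ := generalized_tube_lemma (isCompact_univ (X := M))
    (isCompact_singleton (x := (0 : I))) (hN.preimage hq) (by
      rintro ⟨m, t⟩ ⟨-, rfl⟩
      simpa [hqp] using hpN)
  obtain ⟨t, ht0, htv⟩ : ∃ t : I, 0 < t ∧ t ∈ v := by
    have hv0 : v ∈ nhds (0 : I) := hv.mem_nhds (h0v rfl)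
    obtain ⟨b, hb, hbv⟩ := exists_Ico_subset_of_mem_nhds hv0 ⟨1, zero_lt_one⟩
    obtain ⟨t, ht0, htb⟩ := exists_between hb
    exact ⟨t, ht0, hbv ⟨ht0.le, htb⟩⟩
  have hqN (m : M) : q (m, t) ∈ N := huv ⟨hu (mem_univ m), htv⟩
  have hqU (m : M) : q (m, t) ∈ U := by
    obtain ⟨y, -, hy⟩ := hqN m
    exact hy ▸ y.2
  have hqB (m : M) : (e ⟨q (m, t), hqU m⟩ : E) ∈ Metric.ball c r := by
    obtain ⟨y, hy, hyq⟩ := hqN m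
    have : y = ⟨q (m, t), hqU m⟩ := Subtype.ext hyq
    exact this ▸ hy
  have hqc (m : M) : (e ⟨q (m, t), hqU m⟩ : E) ≠ c := by
    intro hm
    have := congr_arg Subtype.val (e.injective (Subtype.ext hm))
    have := congr_arg h this
    rw [hhq, hp0] at this
    exact ht0.ne' this
  have ht1 : t < 1 := by
    have := (hW _).1 (hrW (hqB x)).1
    simpa [hhq] using this
  let Y : Set E := Metric.ball c r \ {c}
  let φ : C(M, Y) := ⟨fun m ↦ ⟨e ⟨q (m, t), hqU m⟩, hqB m, hqc m⟩, by fun_prop⟩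
  have hYh (y : Y) : (e.symm ⟨y, (hrW y.2.1).2⟩ : X) ∈ h ⁻¹' Ioo 0 1 := by
    refine ⟨pos_iff_ne_zero.2 fun h0 ↦ y.2.2 ?_, (hW _).1 (hrW y.2.1).1⟩
    have : e.symm ⟨y, (hrW y.2.1).2⟩ = ⟨p, hpU⟩ := Subtype.ext (hp _ h0)
    rw [e.symm_apply_eq] at this
    exact congr_arg Subtype.val this
  let ψ : C(Y, M) := ⟨fun y ↦ ρ (e.symm ⟨y, (hrW y.2.1).2⟩),
    hρ.comp_continuous (by fun_prop) hYh⟩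
  refine Path.Homotopic.refl_of_leftInverse φ ψ (fun m ↦ ?_)
    ((convex_ball c r).loop_homotopic_refl_diff_singleton hE Metric.isOpen_ball
      (Metric.mem_ball_self hr)) x γ
  simp only [φ, ψ, ContinuousMap.coe_mk, Subtype.coe_eta, Homeomorph.symm_apply_apply]
  exact hρq m t ⟨ht0, ht1⟩

namespace TopSusp

variable {M : Type*} [TopologicalSpace M]

/-- The height of a point in the suspension. -/
def height (x : TopSusp M) : I :=
  Quot.lift Prod.snd (by rintro a b (rfl | ⟨ha, hb⟩ | ⟨ha, hb⟩) <;> simp_all) x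

open Classical in
/-- The projection of the suspension to the base, constant on the suspension points. -/
noncomputable def proj (m₀ : M) (x : TopSusp M) : M :=
  Quot.lift (fun a : M × I ↦ if a.2 ∈ Ioo (0 : I) 1 then a.1 else m₀)
    (by rintro a b (rfl | ⟨ha, hb⟩ | ⟨ha, hb⟩) <;> simp_all) x

theorem continuous_height : Continuous (height : TopSusp M → I) :=
  continuous_quot_lift _ continuous_snd

theorem continuous_suspPt : Continuous fun a : M × I ↦ suspPt a.1 a.2 :=
  continuous_quot_mk

@[simp]
theorem height_suspPt (m : M) (t : I) : height (suspPt m t) = t := rfl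

theorem proj_suspPt (m₀ m : M) {t : I} (ht : t ∈ Ioo (0 : I) 1) :
    proj m₀ (suspPt m t) = m :=
  if_pos ht

theorem exists_suspPt_eq (x : TopSusp M) : ∃ m t, suspPt m t = x :=
  Quot.inductionOn x fun a ↦ ⟨a.1, a.2, rfl⟩

theorem suspPt_zero (m m' : M) : suspPt m 0 = suspPt m' 0 :=
  Quot.sound (.inr (.inl ⟨rfl, rfl⟩))

theorem suspPt_one (m m' : M) : suspPt m 1 = suspPt m' 1 :=
  Quot.sound (.inr (.inr ⟨rfl, rfl⟩))

theorem continuousOn_proj (m₀ : M) : ContinuousOn (proj m₀) (height ⁻¹' Ioo 0 1) := by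
  rw [continuousOn_iff']
  intro A hA
  refine ⟨proj m₀ ⁻¹' A ∩ height ⁻¹' Ioo 0 1, ?_, by rw [inter_assoc, inter_self]⟩
  refine (isQuotientMap_quot_mk (r := SuspRel M)).isOpen_preimage.1 ?_
  convert! hA.prod (isOpen_Ioo (a := (0 : I)) (b := 1)) using 1
  ext ⟨m, t⟩
  refine and_congr_left fun ht ↦ ?_
  exact iff_of_eq (congr_arg (· ∈ A) (proj_suspPt m₀ m ht))

end TopSusp

/-- If `M` is a closed connected `k`-manifold (`k ≥ 2`) with nontrivial fundamental group,
then `susp(M)` is not a `(k+1)`-manifold: each suspension point has no open neighborhood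
homeomorphic to an open subset of `ℝ^{k+1}`. -/
theorem susp_not_manifold_of_nontrivial_pi1 (k : ℕ) (hk : 2 ≤ k)
    (M : Type) [TopologicalSpace M] [CompactSpace M] [SecondCountableTopology M]
    [T2Space M] [ConnectedSpace M]
    (hman : ∀ x : M, ∃ U : Set M, IsOpen U ∧ x ∈ U ∧
      Nonempty (↥U ≃ₜ EuclideanSpace ℝ (Fin k)))
    (x₀ : M) (hpi1 : Nontrivial (FundamentalGroup M x₀)) :
    ∀ (z : M) (t : I), t = 0 ∨ t = 1 →
      ¬ ∃ U : Set (TopSusp M), IsOpen U ∧ suspPt z t ∈ U ∧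
          ∃ V : Set (EuclideanSpace ℝ (Fin (k + 1))), IsOpen V ∧ Nonempty (↥U ≃ₜ ↥V) := by
  rintro z t ht ⟨U, hU, hzU, V, hV, ⟨e⟩⟩
  have hE : 2 < Module.finrank ℝ (EuclideanSpace ℝ (Fin (k + 1))) := by
    rw [finrank_euclideanSpace_fin]; lia
  have hloop (γ : Path x₀ x₀) : γ.Homotopic (Path.refl x₀) := by
    rcases ht with rfl | rfl
    · refine loop_homotopic_refl_of_conical hE TopSusp.continuous_height
        TopSusp.continuous_suspPt (fun _ ↦ rfl) (fun m ↦ TopSusp.suspPt_zero m z) rfl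
        (fun x hx ↦ ?_) (TopSusp.continuousOn_proj z)
        (fun m t ht ↦ TopSusp.proj_suspPt z m ht) hU hzU hV e x₀ γ
      obtain ⟨m, t, rfl⟩ := TopSusp.exists_suspPt_eq x
      obtain rfl : t = 0 := hx
      exact TopSusp.suspPt_zero m z
    · have hIoo (t : I) : σ t ∈ Ioo (0 : I) 1 ↔ t ∈ Ioo (0 : I) 1 := by
        simp only [mem_Ioo, ← Subtype.coe_lt_coe, coe_symm_eq, Icc.coe_zero, Icc.coe_one]
        constructor <;> rintro ⟨h0, h1⟩ <;> constructor <;> linarith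
      refine loop_homotopic_refl_of_conical (h := fun x : TopSusp M ↦ σ x.height)
        (q := fun a ↦ suspPt a.1 (σ a.2)) hE
        (continuous_symm.comp TopSusp.continuous_height)
        (TopSusp.continuous_suspPt.comp (by fun_prop : Continuous fun a : M × I ↦ (a.1, σ a.2)))
        (fun _ ↦ by simp) (fun m ↦ ?_) (by simp)
        (fun x hx ↦ ?_) ((TopSusp.continuousOn_proj z).mono fun x hx ↦ (hIoo _).1 hx)
        (fun m t ht ↦ TopSusp.proj_suspPt z m ((hIoo t).2 ht)) hU hzU hV e x₀ γ
      · simpa using TopSusp.suspPt_one m z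
      · obtain ⟨m, t, rfl⟩ := TopSusp.exists_suspPt_eq x
        obtain rfl : t = 1 := by simpa using hx
        exact TopSusp.suspPt_one m z
  refine not_subsingleton (FundamentalGroup M x₀) ⟨fun a b ↦ ?_⟩
  have h (a : FundamentalGroup M x₀) : a = 1 :=
    Quotient.inductionOn a fun γ ↦ Quotient.sound (hloop γ)
  rw [h a, h b]
end
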